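/- There is no infinite set D ⊆ (0, 1/2) for which there exist disjoint regular languages L₀, L₁ over the alphabet {0,1} such that L₀ ∪ L₁ has the prefix property and, for every p ∈ D, P_p(L₀ ∪ L₁) = 1 and P_p(L₁) = 2p. (A 2p-coin cannot be simulated by a finite automaton on any infinite set of biases.) -/

import Mathlib

/-- Probability of a word `w` under i.i.d. `p`-coin tosses. -/
noncomputable def wordProb (p : ℝ) (w : List Bool) : ℝ :=
  p ^ (w.count true) * (1 - p) ^ (w.count false)

/-- Probability of a language under i.i.d. `p`-coin tosses. -/
noncomputable def langProb (p : ℝ) (L : Set (List Bool)) : ℝ :=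
  ∑' w : L, wordProb p (w : List Bool)

/-- A language has the prefix property if no word of it is a proper prefix
of another word of it. -/
def PrefixFree (L : Set (List Bool)) : Prop :=
  ∀ u ∈ L, ∀ v ∈ L, u ≠ v → ¬ u <+: v

open Polynomial

theorem hasSum_list_bool {f : List Bool → ℝ} {a b : ℝ}
    (ha : HasSum (fun w => f (true :: w)) a) (hb : HasSum (fun w => f (false :: w)) b) :
    HasSum f (f [] + (a + b)) := by
  have key : ∀ (c : Bool) (x : ℝ), HasSum (fun w => f (c :: w)) x →
      HasSum ((Set.range (List.cons c)).indicator f) x := by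
    intro c x hx
    refine (Function.Injective.hasSum_iff (g := List.cons c) List.cons_injective ?_).1 ?_
    · intro w hw
      exact Set.indicator_of_notMem hw f
    · convert hx using 2 with w
      simp
  have h0 : HasSum (({[]} : Set (List Bool)).indicator f) (f []) := by
    convert hasSum_single (f := ({[]} : Set (List Bool)).indicator f) [] ?_ using 1
    · simp
    · intro w hw
      simp [hw]
  convert h0.add ((key true a ha).add (key false b hb)) using 1
  ext w
  rcases w with _ | ⟨_ | _, w⟩ <;> simp [Set.indicator]

theorem wordProb_nil (p : ℝ) : wordProb p [] = 1 := by simp [wordProb]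

theorem wordProb_true_cons (p : ℝ) (w : List Bool) :
    wordProb p (true :: w) = p * wordProb p w := by
  simp [wordProb, pow_succ]; ring

theorem wordProb_false_cons (p : ℝ) (w : List Bool) :
    wordProb p (false :: w) = (1 - p) * wordProb p w := by
  simp [wordProb, pow_succ]; ring

theorem wordProb_nonneg {p : ℝ} (hp : p ∈ Set.Ioo (0 : ℝ) 1) (w : List Bool) :
    0 ≤ wordProb p w :=
  mul_nonneg (pow_nonneg hp.1.le _) (pow_nonneg (by linarith [hp.2]) _)

theorem PrefixFree.mono {K L : Set (List Bool)} (hL : PrefixFree L) (h : K ⊆ L) :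
    PrefixFree K :=
  fun u hu v hv => hL u (h hu) v (h hv)

theorem PrefixFree.preimage_append {L : Set (List Bool)} (hL : PrefixFree L) (x : List Bool) :
    PrefixFree {w | x ++ w ∈ L} := by
  intro u hu v hv huv h
  exact hL _ hu _ hv (by simpa using huv) ((List.prefix_append_right_inj x).2 h)

theorem PrefixFree.preimage_cons {L : Set (List Bool)} (hL : PrefixFree L) (a : Bool) :
    PrefixFree {w | a :: w ∈ L} :=
  hL.preimage_append [a]

theorem PrefixFree.cons_notMem {L : Set (List Bool)} (hL : PrefixFree L) (h : [] ∈ L)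
    (a : Bool) (w : List Bool) : a :: w ∉ L :=
  fun hw => hL _ h _ hw (by simp) ⟨_, rfl⟩

/-- Conditioning on the first letter. -/
theorem hasSum_indicator_wordProb {p x y : ℝ} {K : Set (List Bool)}
    (hx : HasSum ({w | true :: w ∈ K}.indicator (wordProb p)) x)
    (hy : HasSum ({w | false :: w ∈ K}.indicator (wordProb p)) y) :
    HasSum (K.indicator (wordProb p))
      (K.indicator 1 [] + (p * x + (1 - p) * y)) := by
  have ht : (fun w => K.indicator (wordProb p) (true :: w)) =
      fun w => p * {w | true :: w ∈ K}.indicator (wordProb p) w := by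
    ext w
    simp [Set.indicator, wordProb_true_cons]
  have hf : (fun w => K.indicator (wordProb p) (false :: w)) =
      fun w => (1 - p) * {w | false :: w ∈ K}.indicator (wordProb p) w := by
    ext w
    simp [Set.indicator, wordProb_false_cons]
  convert hasSum_list_bool (ht ▸ hx.mul_left p) (hf ▸ hy.mul_left (1 - p)) using 2
  simp [Set.indicator, wordProb_nil]

theorem PrefixFree.exists_hasSum_le_one_of_length {p : ℝ} (hp : p ∈ Set.Ioo (0 : ℝ) 1) (n : ℕ) :
    ∀ K : Set (List Bool), PrefixFree K → (∀ w ∈ K, w.length < n) →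
      ∃ x ≤ 1, HasSum (K.indicator (wordProb p)) x := by
  induction n with
  | zero =>
    intro K _ hn
    obtain rfl : K = ∅ := Set.eq_empty_of_forall_notMem fun w hw => Nat.not_lt_zero _ (hn w hw)
    exact ⟨0, zero_le_one, by simp⟩
  | succ n ih =>
    intro K hK hn
    by_cases h : [] ∈ K
    · obtain rfl : K = {[]} := by
        ext w
        rcases w with _ | ⟨a, w⟩
        · simpa using h
        · simpa using hK.cons_notMem h a w
      refine ⟨1, le_rfl, ?_⟩
      convert hasSum_single (f := ({[]} : Set (List Bool)).indicator (wordProb p)) [] ?_ using 1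
      · simp [wordProb_nil]
      · intro w hw
        simp [hw]
    · have hl : ∀ a, ∀ w ∈ {w | a :: w ∈ K}, w.length < n := fun a w hw => by
        simpa using hn _ hw
      obtain ⟨x, hx1, hx⟩ := ih _ (hK.preimage_cons true) (hl true)
      obtain ⟨y, hy1, hy⟩ := ih _ (hK.preimage_cons false) (hl false)
      refine ⟨_, ?_, hasSum_indicator_wordProb hx hy⟩
      simp only [Set.indicator_of_notMem h]
      nlinarith [hp.1, hp.2]

theorem PrefixFree.sum_le_one {p : ℝ} (hp : p ∈ Set.Ioo (0 : ℝ) 1) {K : Set (List Bool)}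
    (hK : PrefixFree K) (s : Finset (List Bool)) : ∑ w ∈ s, K.indicator (wordProb p) w ≤ 1 := by
  obtain ⟨x, hx1, hx⟩ := exists_hasSum_le_one_of_length hp (s.sup List.length + 1) (K ∩ s)
    (hK.mono Set.inter_subset_left)
    (fun w hw => Nat.lt_succ_of_le (Finset.le_sup (f := List.length) hw.2))
  refine le_trans (le_of_eq ?_) ((sum_le_hasSum s (fun w _ => ?_) hx).trans hx1)
  · refine Finset.sum_congr rfl fun w hw => ?_
    by_cases hwK : w ∈ K <;> simp [hwK, hw]
  · exact Set.indicator_nonneg (fun w _ => wordProb_nonneg hp w) w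

theorem PrefixFree.summable {p : ℝ} (hp : p ∈ Set.Ioo (0 : ℝ) 1) {K : Set (List Bool)}
    (hK : PrefixFree K) : Summable (K.indicator (wordProb p)) :=
  summable_of_sum_le (Set.indicator_nonneg fun w _ => wordProb_nonneg hp w) (hK.sum_le_one hp)

theorem langProb_eq_tsum_indicator (p : ℝ) (K : Set (List Bool)) :
    langProb p K = ∑' w, K.indicator (wordProb p) w :=
  tsum_subtype K (wordProb p)

theorem PrefixFree.hasSum {p : ℝ} (hp : p ∈ Set.Ioo (0 : ℝ) 1) {K : Set (List Bool)}
    (hK : PrefixFree K) : HasSum (K.indicator (wordProb p)) (langProb p K) :=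
  langProb_eq_tsum_indicator p K ▸ (hK.summable hp).hasSum

/-- **Kraft's inequality** for a biased coin. -/
theorem PrefixFree.langProb_le_one {p : ℝ} (hp : p ∈ Set.Ioo (0 : ℝ) 1) {K : Set (List Bool)}
    (hK : PrefixFree K) : langProb p K ≤ 1 :=
  langProb_eq_tsum_indicator p K ▸ (hK.summable hp).tsum_le_of_sum_le (hK.sum_le_one hp)

theorem PrefixFree.langProb_eq {p : ℝ} (hp : p ∈ Set.Ioo (0 : ℝ) 1) {K : Set (List Bool)}
    (hK : PrefixFree K) :
    langProb p K = K.indicator 1 [] +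
      (p * langProb p {w | true :: w ∈ K} + (1 - p) * langProb p {w | false :: w ∈ K}) := by
  refine (hK.hasSum hp).unique ?_
  convert hasSum_indicator_wordProb ((hK.preimage_cons true).hasSum hp)
    ((hK.preimage_cons false).hasSum hp) using 2

theorem langProb_empty (p : ℝ) : langProb p ∅ = 0 := by simp [langProb]

section Transition

variable {σ : Type*} [Fintype σ] [DecidableEq σ]

open Classical in
/-- The identity minus the transition matrix of an automaton with transition map `step`, where
`K q` is the language accepted from `q` and the states that accept nothing are absorbing with
weight zero. The formal variable is the bias of the coin. -/
noncomputable def transitionMatrix (step : σ → Bool → σ) (K : σ → Set (List Bool)) :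
    Matrix σ σ ℝ[X] :=
  1 - Matrix.of fun q r =>
    if K q = ∅ then 0 else
      (if step q true = r then X else 0) + (if step q false = r then 1 - X else 0)

open Classical in
theorem transitionMatrix_eval_mulVec (step : σ → Bool → σ) (K : σ → Set (List Bool)) (p : ℝ)
    (v : σ → ℝ) (q : σ) :
    ((transitionMatrix step K).map (evalRingHom p)).mulVec v q =
      v q - if K q = ∅ then 0 else p * v (step q true) + (1 - p) * v (step q false) := by
  have : (transitionMatrix step K).map (evalRingHom p) = 1 - Matrix.of fun q r =>
      if K q = ∅ then (0 : ℝ) else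
        (if step q true = r then p else 0) + (if step q false = r then 1 - p else 0) := by
    ext q r
    simp only [transitionMatrix, Matrix.map_apply, Matrix.sub_apply, Matrix.of_apply, map_sub,
      Matrix.one_apply]
    split_ifs <;> simp
  rw [this, Matrix.sub_mulVec, Matrix.one_mulVec]
  simp only [Pi.sub_apply, Matrix.mulVec, dotProduct, Matrix.of_apply]
  split_ifs <;> simp [add_mul, Finset.sum_add_distrib]

theorem eval_det_transitionMatrix_ne_zero {step : σ → Bool → σ} {K : σ → Set (List Bool)}
    (hK : ∀ q, PrefixFree (K q)) (hstep : ∀ q a, K (step q a) = {w | a :: w ∈ K q})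
    {p : ℝ} (hp : p ∈ Set.Ioo (0 : ℝ) 1) : (transitionMatrix step K).det.eval p ≠ 0 := by
  classical
  intro h0
  rw [← coe_evalRingHom, RingHom.map_det] at h0
  obtain ⟨v, hv0, hv⟩ := Matrix.exists_mulVec_eq_zero_iff.2 h0
  have hv' (q : σ) :
      v q = if K q = ∅ then 0 else p * v (step q true) + (1 - p) * v (step q false) := by
    have := (transitionMatrix_eval_mulVec step K p v q).symm.trans (congrFun hv q)
    exact sub_eq_zero.1 this
  obtain ⟨q₀, hq₀⟩ := Function.ne_iff.1 hv0
  obtain ⟨m, -, hm⟩ := Finset.exists_max_image Finset.univ (fun q => |v q|) ⟨q₀, by simp⟩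
  have hpos : 0 < |v m| := (abs_pos.2 hq₀).trans_le (hm q₀ (by simp))
  have hle (q : σ) : |v q| ≤ |v m| := hm q (by simp)
  have hzero (q : σ) (h : K q = ∅) : v q = 0 := by rw [hv' q, if_pos h]
  have key : ∀ (w : List Bool) (q : σ), w ∈ K q → |v q| ≠ |v m| := by
    intro w
    induction w with
    | nil =>
      intro q hw hq
      have he (a : Bool) : v (step q a) = 0 := hzero _ <| by
        rw [hstep]
        exact Set.eq_empty_of_forall_notMem fun w => (hK q).cons_notMem hw a w
      have : v q = 0 := by rw [hv' q, he, he]; simp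
      rw [← hq, this, abs_zero] at hpos
      exact hpos.false
    | cons a w ih =>
      intro q hw hq
      refine ih (step q a) (by rw [hstep]; exact hw) (le_antisymm (hle _) ?_)
      have hne : K q ≠ ∅ := fun h => by simp [h] at hw
      have h1 : |v q| ≤ p * |v (step q true)| + (1 - p) * |v (step q false)| := by
        have h1p : 0 < 1 - p := sub_pos.2 hp.2
        rw [hv' q, if_neg hne]
        refine (abs_add_le _ _).trans (le_of_eq ?_)
        rw [abs_mul, abs_mul, abs_of_pos hp.1, abs_of_pos h1p]
      have ht := hle (step q true)
      have hf := hle (step q false)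
      rw [hq] at h1
      by_contra! hlt
      have h1p : 0 < 1 - p := sub_pos.2 hp.2
      cases a
      · nlinarith [mul_lt_mul_of_pos_left hlt h1p, mul_le_mul_of_nonneg_left ht hp.1.le]
      · nlinarith [mul_lt_mul_of_pos_left hlt hp.1, mul_le_mul_of_nonneg_left hf h1p.le]
  have hne : K m ≠ ∅ := fun h => by simp [hzero m h] at hpos
  obtain ⟨w, hw⟩ := Set.nonempty_iff_ne_empty.2 hne
  exact key w m hw rfl

open Classical in
theorem eval_det_transitionMatrix_mul_langProb {step : σ → Bool → σ} {K : σ → Set (List Bool)}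
    (hK : ∀ q, PrefixFree (K q)) (hstep : ∀ q a, K (step q a) = {w | a :: w ∈ K q})
    {p : ℝ} (hp : p ∈ Set.Ioo (0 : ℝ) 1) (q : σ) :
    (transitionMatrix step K).det.eval p * langProb p (K q) =
      ((transitionMatrix step K).adjugate.mulVec (fun r => if [] ∈ K r then 1 else 0) q).eval p := by
  set N := transitionMatrix step K
  set b : σ → ℝ[X] := fun r => if [] ∈ K r then 1 else 0 with hb
  have hf : (N.map (evalRingHom p)).mulVec (fun q => langProb p (K q)) =
      evalRingHom p ∘ b := by
    ext q
    rw [transitionMatrix_eval_mulVec]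
    split_ifs with h
    · simp [b, h, langProb_empty]
    · rw [(hK q).langProb_eq hp, hstep, hstep, add_sub_cancel_right]
      simp only [hb, Set.indicator, Function.comp_apply]
      split_ifs <;> simp
  have hdet : N.det.eval p = (N.map (evalRingHom p)).det := RingHom.map_det (evalRingHom p) N
  have hadj : N.adjugate.map (evalRingHom p) = (N.map (evalRingHom p)).adjugate :=
    RingHom.map_adjugate (evalRingHom p) N
  have hsolve := congrArg (Matrix.mulVec (N.map (evalRingHom p)).adjugate) hf
  rw [Matrix.mulVec_mulVec, Matrix.adjugate_mul, Matrix.smul_mulVec, Matrix.one_mulVec,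
    ← hadj, ← hdet] at hsolve
  exact (congrFun hsolve q).trans (RingHom.map_mulVec (evalRingHom p) N.adjugate b q).symm

end Transition

/-- The probability of a regular prefix-free language is a rational function of the bias, with no
poles in the open unit interval. -/
theorem PrefixFree.exists_polynomial_langProb {L : Set (List Bool)} (hL : PrefixFree L)
    (hreg : Language.IsRegular (L : Language Bool)) :
    ∃ d g : ℝ[X], ∀ p ∈ Set.Ioo (0 : ℝ) 1, d.eval p ≠ 0 ∧ d.eval p * langProb p L = g.eval p := by
  classical
  let M := Language.toDFA (α := Bool) L
  have : Fintype (Set.range (Language.leftQuotient (α := Bool) L)) :=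
    hreg.finite_range_leftQuotient.fintype
  let K : Set.range (Language.leftQuotient (α := Bool) L) → Set (List Bool) := fun q => q.1
  have hK : ∀ q, PrefixFree (K q) := by
    rintro ⟨_, x, rfl⟩
    exact hL.preimage_append x
  have hstep : ∀ q a, K (M.step q a) = {w | a :: w ∈ K q} := fun q a => rfl
  exact ⟨_, _, fun p hp => ⟨eval_det_transitionMatrix_ne_zero hK hstep hp,
    eval_det_transitionMatrix_mul_langProb hK hstep hp M.start⟩⟩

theorem stmt_17 :
    ¬ ∃ D : Set ℝ, D ⊆ Set.Ioo (0:ℝ) (1/2) ∧ D.Infinite ∧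
      ∃ L₀ L₁ : Set (List Bool),
        Language.IsRegular (L₀ : Language Bool) ∧
        Language.IsRegular (L₁ : Language Bool) ∧
        Disjoint L₀ L₁ ∧
        PrefixFree (L₀ ∪ L₁) ∧
        ∀ p ∈ D, langProb p (L₀ ∪ L₁) = 1 ∧ langProb p L₁ = 2 * p := by
  rintro ⟨D, hD, hinf, L₀, L₁, -, hreg, -, hpf, hprob⟩
  have hL : PrefixFree L₁ := hpf.mono Set.subset_union_right
  obtain ⟨d, g, h⟩ := hL.exists_polynomial_langProb hreg
  have heq : d * (C 2 * X) = g := by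
    refine eq_of_infinite_eval_eq _ _ (hinf.mono fun p hp => ?_)
    have hp1 := hD hp
    have := (h p ⟨hp1.1, by linarith [hp1.2]⟩).2
    rw [(hprob p hp).2] at this
    simpa using this
  have hp : (3 / 4 : ℝ) ∈ Set.Ioo (0 : ℝ) 1 := by constructor <;> norm_num
  obtain ⟨hd, hg⟩ := h _ hp
  rw [← heq, eval_mul] at hg
  have hval := mul_left_cancel₀ hd hg
  have hle := hL.langProb_le_one hp
  rw [hval] at hle
  norm_num at hle
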